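/- Let X be a set and let σ and τ be topologies on X such that τ = σ^d (i.e., τ arises as a dual topology). If moreover τ^{dd} = τ^d, then τ^d = τ. That is, a topology arising as a dual cannot belong to the class G_{2b} without belonging to G_1. -/

import Mathlib

/-- A set is *saturated* in a topological space if it is an intersection of open sets. -/
def IsSaturatedSet {X : Type*} (t : TopologicalSpace X) (A : Set X) : Prop :=
  ∃ S : Set (Set X), (∀ U ∈ S, t.IsOpen U) ∧ A = ⋂₀ S

/-- The de Groot dual of a topology: the topology generated by taking the compact
saturated sets as a closed base (equivalently, their complements as an open subbase). -/
def deGrootDual {X : Type*} (t : TopologicalSpace X) : TopologicalSpace X :=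
  TopologicalSpace.generateFrom
    {U : Set X | ∃ K : Set X, @IsCompact X t K ∧ IsSaturatedSet t K ∧ U = Kᶜ}

/-- specialization relation -/
def SpecLe {X : Type*} (t : TopologicalSpace X) (x y : X) : Prop :=
  ∀ U, t.IsOpen U → x ∈ U → y ∈ U

theorem sat_iff {X : Type*} (t : TopologicalSpace X) (A : Set X) :
    IsSaturatedSet t A ↔ ∀ x y, SpecLe t x y → x ∈ A → y ∈ A := by
  constructor
  · rintro ⟨S, hS, rfl⟩ x y hxy hx U hU
    exact hxy U (hS U hU) (hx U hU)
  · intro h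
    refine ⟨{U | t.IsOpen U ∧ A ⊆ U}, fun U hU => hU.1, ?_⟩
    apply Set.Subset.antisymm
    · intro x hx U hU
      exact hU.2 hx
    · intro y hy
      by_contra hyA
      have key : ∀ x ∈ A, ∃ U, t.IsOpen U ∧ x ∈ U ∧ y ∉ U := by
        intro x hx
        by_contra hcon
        apply hyA
        apply h x y _ hx
        intro U hU hxU
        by_contra hyU
        exact hcon ⟨U, hU, hxU, hyU⟩
      choose! V hV1 hV2 hV3 using key
      have hmem := hy (⋃₀ (V '' A)) ⟨t.isOpen_sUnion _ (by
        rintro _ ⟨x, hx, rfl⟩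
        exact hV1 x hx), fun x hx => ⟨V x, ⟨x, hx, rfl⟩, hV2 x hx⟩⟩
      obtain ⟨_, ⟨x, hx, rfl⟩, hyx⟩ := hmem
      exact hV3 x hx hyx

theorem specLe_dual {X : Type*} (t : TopologicalSpace X) (x y : X) :
    SpecLe (deGrootDual t) x y ↔ SpecLe t y x := by
  constructor
  · intro h
    -- the saturation of y is compact saturated
    have hc : @IsCompact X t {z | SpecLe t y z} := by
      letI := t
      apply isCompact_of_finite_subcover
      intro ι U hU hcov
      obtain ⟨i, hi⟩ := Set.mem_iUnion.1 (hcov (show SpecLe t y y from fun _ _ h => h))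
      refine ⟨{i}, fun z hz => ?_⟩
      simp only [Finset.mem_singleton, Set.iUnion_iUnion_eq_left]
      exact hz _ (hU i) hi
    have hs : IsSaturatedSet t {z | SpecLe t y z} := by
      rw [sat_iff]
      intro a b hab ha U hU hy
      exact hab U hU (ha U hU hy)
    by_contra hyx
    exact h {z | SpecLe t y z}ᶜ (TopologicalSpace.GenerateOpen.basic _ ⟨_, hc, hs, rfl⟩)
      hyx (fun _ _ h => h)
  · intro h U hU
    change TopologicalSpace.GenerateOpen _ U at hU
    induction hU with
    | basic U hU =>
      obtain ⟨K, -, hs, rfl⟩ := hU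
      intro hx hy
      exact hx ((sat_iff t K).1 hs y x h hy)
    | univ => exact fun _ => trivial
    | inter U V _ _ h1 h2 => exact fun hx => ⟨h1 hx.1, h2 hx.2⟩
    | sUnion S _ ih =>
      rintro ⟨U, hU, hx⟩
      exact ⟨U, hU, ih U hU hx⟩

theorem dual_isClosed {X : Type*} {t : TopologicalSpace X} {K : Set X}
    (hc : @IsCompact X t K) (hs : IsSaturatedSet t K) : @IsClosed X (deGrootDual t) K :=
  @IsClosed.mk X (deGrootDual t) K (TopologicalSpace.GenerateOpen.basic _ ⟨_, hc, hs, rfl⟩)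

/-- Alexander subbase argument in a compact dual. -/
theorem dual_isCompact {X : Type*} {t : TopologicalSpace X} {A : Set X}
    (hX : @IsCompact X (deGrootDual t) Set.univ)
    (hA : ∀ L, @IsCompact X t L → IsSaturatedSet t L → @IsClosed X (deGrootDual t) (A ∩ L)) :
    @IsCompact X (deGrootDual t) A := by
  letI := deGrootDual t
  refine isCompact_generateFrom rfl ?_
  intro P hP hcov
  rcases P.eq_empty_or_nonempty with rfl | hne
  · exact ⟨∅, le_rfl, Set.finite_empty, hcov⟩
  have h1 : (Set.univ : Set X) ⊆ ⋃ U ∈ P, (A ∩ Uᶜ)ᶜ := by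
    intro x _
    simp only [Set.mem_iUnion]
    by_cases hx : x ∈ A
    · obtain ⟨U, hU, hxU⟩ := hcov hx
      exact ⟨U, hU, fun h => h.2 hxU⟩
    · obtain ⟨U, hU⟩ := hne
      exact ⟨U, hU, fun h => hx h.1⟩
  obtain ⟨Q, hQP, hQ, hQc⟩ := hX.elim_finite_subcover_image (b := P)
    (c := fun U => (A ∩ Uᶜ)ᶜ) (by
      intro U hU
      obtain ⟨K, hK, hs, rfl⟩ := hP hU
      have := hA K hK hs
      simpa using this.isOpen_compl) h1
  refine ⟨Q, hQP, hQ, fun x hx => ?_⟩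
  have := hQc (Set.mem_univ x)
  simp only [Set.mem_iUnion] at this
  obtain ⟨U, hU, h⟩ := this
  refine ⟨U, hU, ?_⟩
  by_contra hxU
  exact h ⟨hx, hxU⟩

theorem selfdual_closed {X : Type*} {c : TopologicalSpace X} (hc : deGrootDual c = c)
    (U : Set X) (hU : c.IsOpen U) : U = ∅ ∨ @IsCompact X c Uᶜ := by
  have hU' : TopologicalSpace.GenerateOpen
      {U : Set X | ∃ K : Set X, @IsCompact X c K ∧ IsSaturatedSet c K ∧ U = Kᶜ} U := by
    rw [← hc] at hU
    exact hU
  have hop : ∀ V, TopologicalSpace.GenerateOpen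
      {U : Set X | ∃ K : Set X, @IsCompact X c K ∧ IsSaturatedSet c K ∧ U = Kᶜ} V →
      c.IsOpen V := by
    intro V hV
    rw [← hc]
    exact hV
  clear hU
  letI := c
  induction hU' with
  | basic U hU =>
    obtain ⟨K, hK, -, rfl⟩ := hU
    right
    rwa [compl_compl]
  | univ => right; rw [Set.compl_univ]; exact isCompact_empty
  | inter U V _ _ h1 h2 =>
    rcases h1 with rfl | h1
    · left; simp
    rcases h2 with rfl | h2
    · left; simp
    right
    rw [Set.compl_inter]
    exact h1.union h2
  | sUnion S hS ih =>
    by_cases h : ∃ U ∈ S, IsCompact Uᶜ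
    · obtain ⟨U, hU, hK⟩ := h
      right
      refine hK.of_isClosed_subset ?_ (Set.compl_subset_compl.2 (Set.subset_sUnion_of_mem hU))
      exact isClosed_compl_iff.2 (isOpen_sUnion fun V hV => hop V (hS V hV))
    · left
      rw [Set.sUnion_eq_empty]
      intro U hU
      exact (ih U hU).resolve_right fun hk => h ⟨U, hU, hk⟩

theorem selfdual_compact {X : Type*} {c : TopologicalSpace X} (hc : deGrootDual c = c) :
    @IsCompact X c Set.univ := by
  letI := c
  apply isCompact_of_finite_subcover
  intro ι U hU hcov
  by_cases h : ∃ i, (U i).Nonempty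
  · obtain ⟨i, hi⟩ := h
    have hk := (selfdual_closed hc (U i) (hU i)).resolve_left hi.ne_empty
    obtain ⟨s, hs⟩ := hk.elim_finite_subcover U hU ((Set.subset_univ _).trans hcov)
    classical
    refine ⟨insert i s, fun x _ => ?_⟩
    by_cases hx : x ∈ U i
    · exact Set.mem_biUnion (Finset.mem_insert_self i s) hx
    · obtain ⟨j, hj, hxj⟩ := Set.mem_iUnion₂.1 (hs hx)
      exact Set.mem_biUnion (Finset.mem_insert_of_mem hj) hxj
  · refine ⟨∅, fun x hx => ?_⟩
    obtain ⟨i, hi⟩ := Set.mem_iUnion.1 (hcov hx)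
    exact (h ⟨i, x, hi⟩).elim

theorem isCompact_coarser {X : Type*} {s t : TopologicalSpace X} (hst : s ≤ t) {K : Set X}
    (h : @IsCompact X s K) : @IsCompact X t K := by
  have := @IsCompact.image X X s t K id h (continuous_id_iff_le.2 hst)
  rwa [Set.image_id] at this

theorem dual_topology_G2b_mem_G1 {X : Type*} (σ τ : TopologicalSpace X)
    (h : τ = deGrootDual σ)
    (h2b : deGrootDual (deGrootDual τ) = deGrootDual τ) :
    deGrootDual τ = τ := by
  obtain ⟨c, hcdef⟩ : ∃ c, c = deGrootDual τ := ⟨_, rfl⟩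
  rw [← hcdef] at h2b ⊢
  have hsym : ∀ x y, SpecLe c x y ↔ SpecLe c y x := by
    intro x y
    have := specLe_dual c x y
    rwa [h2b] at this
  have hτ : ∀ x y, SpecLe τ x y ↔ SpecLe c x y := by
    intro x y
    rw [hsym, hcdef, specLe_dual]
  have hσ : ∀ x y, SpecLe σ x y ↔ SpecLe c x y := by
    intro x y
    rw [hsym, ← hτ, h, specLe_dual]
  have sτ : ∀ A, IsSaturatedSet τ A ↔ IsSaturatedSet c A := by
    intro A; simp only [sat_iff, hτ]
  have sσ : ∀ A, IsSaturatedSet σ A ↔ IsSaturatedSet c A := by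
    intro A; simp only [sat_iff, hσ]
  have sinter : ∀ A B, IsSaturatedSet c A → IsSaturatedSet c B → IsSaturatedSet c (A ∩ B) := by
    intro A B hA hB
    rw [sat_iff] at *
    exact fun x y hxy hx => ⟨hA x y hxy hx.1, hB x y hxy hx.2⟩
  have scompl : ∀ A, IsSaturatedSet c A → IsSaturatedSet c Aᶜ := by
    intro A hA
    rw [sat_iff] at *
    exact fun x y hxy hx hy => hx (hA y x ((hsym x y).1 hxy) hy)
  have sopen : ∀ (t : TopologicalSpace X) U, t.IsOpen U → IsSaturatedSet t U := by
    intro t U hU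
    rw [sat_iff]
    exact fun x y hxy hx => hxy U hU hx
  have hX := selfdual_compact h2b
  -- step 1
  have hcτ : c ≤ τ := by
    rw [h]
    refine le_generateFrom ?_
    rintro _ ⟨K, hK, hs, rfl⟩
    have hKτ : @IsClosed X τ K := by rw [h]; exact dual_isClosed hK hs
    have hKc : @IsCompact X c K := by
      rw [hcdef] at hX ⊢
      refine dual_isCompact hX fun L hL hLs => ?_
      refine dual_isClosed ?_ ((sτ _).2 (sinter _ _ ((sσ _).1 hs) ((sτ _).1 hLs)))
      exact @IsCompact.inter_left X τ _ _ hL hKτ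
    have := dual_isClosed hKc ((sσ _).1 hs)
    rw [h2b] at this
    exact this.isOpen_compl
  have hXτ : @IsCompact X τ Set.univ := isCompact_coarser hcτ hX
  -- step 2
  have hcσ : c ≤ σ := by
    intro U hU
    have hs : IsSaturatedSet c Uᶜ := scompl _ ((sσ _).1 (sopen σ U hU))
    have hF : @IsClosed X σ Uᶜ := (@isClosed_compl_iff X σ U).2 hU
    have hk : @IsCompact X τ Uᶜ := by
      rw [h] at hXτ ⊢
      refine dual_isCompact hXτ fun L hL hLs => ?_
      refine dual_isClosed ?_ ((sσ _).2 (sinter _ _ hs ((sσ _).1 hLs)))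
      exact @IsCompact.inter_left X σ _ _ hL hF
    have := dual_isClosed hk ((sτ _).2 hs)
    rw [← hcdef] at this
    exact (@isClosed_compl_iff X c U).1 this
  refine le_antisymm hcτ ?_
  intro U hU
  have hs : IsSaturatedSet c Uᶜ := scompl _ (sopen c U hU)
  have hk : @IsCompact X c Uᶜ :=
    @IsCompact.of_isClosed_subset X c _ _ hX ((@isClosed_compl_iff X c U).2 hU) (Set.subset_univ _)
  have := dual_isClosed (isCompact_coarser hcσ hk) ((sσ _).2 hs)
  rw [← h] at this
  exact (@isClosed_compl_iff X τ U).1 this
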